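/- Let (p_n) be a nonnegative sequence with generating function F(z) = ∑_n p_n z^n satisfying F(z) ~ C/(1-z)^α as z → 1⁻ for some C > 0 and α > 0 not a nonpositive integer, and assume (Hardy–Littlewood–Karamata Tauberian conditions, e.g. p_n monotone or F analytic off z=1). Then p_n ~ (C/Γ(α))·n^{α-1} as n → ∞. -/

import Mathlib

open Filter Topology MeasureTheory Set

/-- The substitution `t = exp (-s)` makes the Gamma density integrable against any continuous
function on `[0, 1]`. -/
theorem integrableOn_comp_exp_neg_mul_gamma {α : ℝ} (hα : 0 < α) {f : ℝ → ℝ} (hf : Continuous f) :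
    IntegrableOn (fun s : ℝ => f (Real.exp (-s)) * (Real.exp (-s) * s ^ (α - 1))) (Ioi 0) := by
  obtain ⟨K, hK⟩ := isCompact_Icc.exists_bound_of_continuousOn (s := Icc (0 : ℝ) 1) hf.continuousOn
  refine (Real.GammaIntegral_convergent hα).bdd_mul (c := K) (by fun_prop) ?_
  refine (ae_restrict_iff' measurableSet_Ioi).2 (ae_of_all _ fun s hs => hK _ ⟨by positivity, ?_⟩)
  exact Real.exp_le_one_iff.2 (by simpa using (mem_Ioi.1 hs).le)

theorem integral_exp_neg_pow_mul_gamma {α : ℝ} (hα : 0 < α) (j : ℕ) :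
    ∫ s in Ioi (0 : ℝ), Real.exp (-s) ^ j * (Real.exp (-s) * s ^ (α - 1)) =
      (1 / ((j : ℝ) + 1)) ^ α * Real.Gamma α := by
  rw [← Real.integral_rpow_mul_exp_neg_mul_Ioi hα (by positivity : (0 : ℝ) < (j : ℝ) + 1)]
  refine integral_congr_ae (ae_of_all _ fun s => ?_)
  have : Real.exp (-(((j : ℝ) + 1) * s)) = Real.exp (-s) ^ j * Real.exp (-s) := by
    rw [← pow_succ, ← Real.exp_nat_mul]
    push_cast
    ring_nf
  simp only [this]
  ring

section Karamata

variable {p : ℕ → ℝ} {C α : ℝ}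

theorem eventually_summable_of_tendsto (hC : 0 < C)
    (hF : Tendsto (fun z : ℝ => (∑' n : ℕ, p n * z ^ n) * (1 - z) ^ α) (𝓝[Ioo 0 1] 1) (𝓝 C)) :
    ∀ᶠ z in 𝓝[Ioo 0 1] (1 : ℝ), Summable fun n : ℕ => p n * z ^ n := by
  filter_upwards [hF.eventually_ne hC.ne'] with z hz
  by_contra h
  simp [tsum_eq_zero_of_not_summable h] at hz

theorem summable_mul_of_continuous (hpos : ∀ n, 0 ≤ p n) {f : ℝ → ℝ} (hf : Continuous f) {z : ℝ}
    (hz : z ∈ Ioo (0 : ℝ) 1) (hs : Summable fun n : ℕ => p n * z ^ n) :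
    Summable fun n : ℕ => p n * z ^ n * f (z ^ n) := by
  obtain ⟨K, hK⟩ := isCompact_Icc.exists_bound_of_continuousOn (s := Icc (0 : ℝ) 1) hf.continuousOn
  refine Summable.of_norm_bounded (hs.mul_right K) fun n => ?_
  have h0 : 0 ≤ p n * z ^ n := mul_nonneg (hpos n) (pow_nonneg hz.1.le n)
  rw [norm_mul, Real.norm_of_nonneg h0]
  exact mul_le_mul_of_nonneg_left
    (hK _ ⟨pow_nonneg hz.1.le n, pow_le_one₀ hz.1.le hz.2.le⟩) h0

theorem tendsto_weighted_sum_pow (hα : 0 < α)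
    (hF : Tendsto (fun z : ℝ => (∑' n : ℕ, p n * z ^ n) * (1 - z) ^ α) (𝓝[Ioo 0 1] 1) (𝓝 C))
    (j : ℕ) :
    Tendsto (fun z : ℝ => (1 - z) ^ α * ∑' n : ℕ, p n * z ^ n * (z ^ n) ^ j) (𝓝[Ioo 0 1] 1)
      (𝓝 (C / Real.Gamma α *
        ∫ s in Ioi (0 : ℝ), Real.exp (-s) ^ j * (Real.exp (-s) * s ^ (α - 1)))) := by
  have hpow : Tendsto (fun z : ℝ => z ^ (j + 1)) (𝓝[Ioo 0 1] 1) (𝓝[Ioo 0 1] 1) := by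
    refine tendsto_nhdsWithin_iff.2 ⟨?_, ?_⟩
    · have : Continuous fun z : ℝ => z ^ (j + 1) := by fun_prop
      simpa using (this.tendsto 1).mono_left nhdsWithin_le_nhds
    · filter_upwards [self_mem_nhdsWithin] with z hz
      exact ⟨pow_pos hz.1 _, pow_lt_one₀ hz.1.le hz.2 (by simp)⟩
  have hgeom : Tendsto (fun z : ℝ => (1 / ∑ i ∈ Finset.range (j + 1), z ^ i) ^ α) (𝓝[Ioo 0 1] 1)
      (𝓝 ((1 / ((j : ℝ) + 1)) ^ α)) := by
    have : Continuous fun z : ℝ => ∑ i ∈ Finset.range (j + 1), z ^ i := by fun_prop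
    have h1 : Tendsto (fun z : ℝ => ∑ i ∈ Finset.range (j + 1), z ^ i) (𝓝[Ioo 0 1] 1)
        (𝓝 ((j : ℝ) + 1)) := by
      simpa using (this.tendsto 1).mono_left nhdsWithin_le_nhds
    exact (tendsto_const_nhds.div h1 (by positivity)).rpow_const (Or.inr hα.le)
  rw [integral_exp_neg_pow_mul_gamma hα,
    show C / Real.Gamma α * ((1 / ((j : ℝ) + 1)) ^ α * Real.Gamma α) =
      C * (1 / ((j : ℝ) + 1)) ^ α by field_simp [(Real.Gamma_pos_of_pos hα).ne']]
  refine ((hF.comp hpow).mul hgeom).congr' ?_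
  filter_upwards [self_mem_nhdsWithin] with z hz
  have hsum : 0 < ∑ i ∈ Finset.range (j + 1), z ^ i :=
    Finset.sum_pos (fun i _ => pow_pos hz.1 i) (by simp)
  have hfac : 1 - z ^ (j + 1) = (1 - z) * ∑ i ∈ Finset.range (j + 1), z ^ i :=
    (mul_neg_geom_sum z (j + 1)).symm
  have h1z : 0 ≤ 1 - z := by linarith [hz.2]
  have hrpow : (1 - z ^ (j + 1)) ^ α * (1 / ∑ i ∈ Finset.range (j + 1), z ^ i) ^ α =
      (1 - z) ^ α := by
    rw [hfac, ← Real.mul_rpow (by positivity) (by positivity)]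
    congr 1
    field_simp
  simp only [Function.comp_apply]
  rw [mul_assoc, hrpow, mul_comm]
  congr 1
  refine tsum_congr fun n => ?_
  rw [← pow_mul, ← pow_mul]
  ring

theorem tendsto_weighted_sum_polynomial (hpos : ∀ n, 0 ≤ p n) (hC : 0 < C) (hα : 0 < α)
    (hF : Tendsto (fun z : ℝ => (∑' n : ℕ, p n * z ^ n) * (1 - z) ^ α) (𝓝[Ioo 0 1] 1) (𝓝 C))
    (P : Polynomial ℝ) :
    Tendsto (fun z : ℝ => (1 - z) ^ α * ∑' n : ℕ, p n * z ^ n * P.eval (z ^ n)) (𝓝[Ioo 0 1] 1)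
      (𝓝 (C / Real.Gamma α *
        ∫ s in Ioi (0 : ℝ), P.eval (Real.exp (-s)) * (Real.exp (-s) * s ^ (α - 1)))) := by
  induction P using Polynomial.induction_on' with
  | add P Q hP hQ =>
    have hint : ∫ s in Ioi (0 : ℝ), (P + Q).eval (Real.exp (-s)) * (Real.exp (-s) * s ^ (α - 1)) =
        (∫ s in Ioi (0 : ℝ), P.eval (Real.exp (-s)) * (Real.exp (-s) * s ^ (α - 1))) +
        ∫ s in Ioi (0 : ℝ), Q.eval (Real.exp (-s)) * (Real.exp (-s) * s ^ (α - 1)) := by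
      rw [← integral_add (integrableOn_comp_exp_neg_mul_gamma hα P.continuous)
        (integrableOn_comp_exp_neg_mul_gamma hα Q.continuous)]
      simp only [Polynomial.eval_add, add_mul]
    rw [hint, mul_add]
    refine (hP.add hQ).congr' ?_
    filter_upwards [self_mem_nhdsWithin, eventually_summable_of_tendsto hC hF] with z hz hs
    rw [← mul_add, ← (summable_mul_of_continuous hpos P.continuous hz hs).tsum_add
      (summable_mul_of_continuous hpos Q.continuous hz hs)]
    simp only [Polynomial.eval_add, mul_add]
  | monomial j a =>
    have h := (tendsto_weighted_sum_pow hα hF j).const_mul a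
    convert h using 2 with z
    · have hterm : ∀ n : ℕ, p n * z ^ n * (Polynomial.monomial j a).eval (z ^ n) =
          a * (p n * z ^ n * (z ^ n) ^ j) := fun n => by
        rw [Polynomial.eval_monomial]
        ring
      simp only [hterm, tsum_mul_left]
      ring
    · rw [mul_left_comm, ← integral_const_mul a]
      simp only [Polynomial.eval_monomial, mul_assoc]

/-- Karamata's limit theorem for continuous test functions. -/
theorem tendsto_weighted_sum_continuous (hpos : ∀ n, 0 ≤ p n) (hC : 0 < C) (hα : 0 < α)
    (hF : Tendsto (fun z : ℝ => (∑' n : ℕ, p n * z ^ n) * (1 - z) ^ α) (𝓝[Ioo 0 1] 1) (𝓝 C))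
    {f : ℝ → ℝ} (hf : Continuous f) :
    Tendsto (fun z : ℝ => (1 - z) ^ α * ∑' n : ℕ, p n * z ^ n * f (z ^ n)) (𝓝[Ioo 0 1] 1)
      (𝓝 (C / Real.Gamma α *
        ∫ s in Ioi (0 : ℝ), f (Real.exp (-s)) * (Real.exp (-s) * s ^ (α - 1)))) := by
  have hΓ := Real.Gamma_pos_of_pos hα
  rw [Metric.tendsto_nhds]
  intro ε hε
  obtain ⟨η, hη, hηε⟩ : ∃ η : ℝ, 0 < η ∧ η * (C + 1) + η + C * η < ε := by
    refine ⟨ε / (2 * (2 * C + 2)), by positivity, ?_⟩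
    have : ε / (2 * (2 * C + 2)) * (2 * C + 2) = ε / 2 := by field_simp
    linarith
  obtain ⟨P, hP⟩ := exists_polynomial_near_of_continuousOn 0 1 f hf.continuousOn η hη
  have hlim := Metric.tendsto_nhds.1 (tendsto_weighted_sum_polynomial hpos hC hα hF P) η hη
  have hintegral : |(C / Real.Gamma α *
        ∫ s in Ioi (0 : ℝ), P.eval (Real.exp (-s)) * (Real.exp (-s) * s ^ (α - 1))) -
      C / Real.Gamma α *
        ∫ s in Ioi (0 : ℝ), f (Real.exp (-s)) * (Real.exp (-s) * s ^ (α - 1))| ≤ C * η := by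
    rw [← mul_sub, ← integral_sub (integrableOn_comp_exp_neg_mul_gamma hα P.continuous)
      (integrableOn_comp_exp_neg_mul_gamma hα hf), abs_mul, abs_of_pos (by positivity)]
    have hb : |∫ s in Ioi (0 : ℝ), (P.eval (Real.exp (-s)) * (Real.exp (-s) * s ^ (α - 1)) -
        f (Real.exp (-s)) * (Real.exp (-s) * s ^ (α - 1)))| ≤ η * Real.Gamma α := by
      rw [Real.Gamma_eq_integral hα, ← integral_const_mul, ← Real.norm_eq_abs]
      refine norm_integral_le_of_norm_le ((Real.GammaIntegral_convergent hα).const_mul η) ?_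
      refine (ae_restrict_iff' measurableSet_Ioi).2 (ae_of_all _ fun s hs => ?_)
      have hs0 : (0 : ℝ) < s := hs
      have hw : 0 ≤ Real.exp (-s) * s ^ (α - 1) := by positivity
      rw [← sub_mul, norm_mul, Real.norm_of_nonneg hw]
      exact mul_le_mul_of_nonneg_right (hP _ ⟨by positivity, by simpa using hs0.le⟩).le hw
    calc C / Real.Gamma α * _ ≤ C / Real.Gamma α * (η * Real.Gamma α) :=
          mul_le_mul_of_nonneg_left hb (by positivity)
      _ = C * η := by field_simp
  filter_upwards [self_mem_nhdsWithin, eventually_summable_of_tendsto hC hF, hlim,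
    hF.eventually_lt_const (lt_add_one C)] with z hz hs hPz hFz
  have h1z : 0 ≤ (1 - z) ^ α := Real.rpow_nonneg (by linarith [hz.2]) _
  have hsum : |(1 - z) ^ α * (∑' n : ℕ, p n * z ^ n * f (z ^ n)) -
      (1 - z) ^ α * ∑' n : ℕ, p n * z ^ n * P.eval (z ^ n)| ≤ η * (C + 1) := by
    rw [← mul_sub, ← (summable_mul_of_continuous hpos hf hz hs).tsum_sub
      (summable_mul_of_continuous hpos P.continuous hz hs), abs_mul, abs_of_nonneg h1z]
    have hb : |∑' n : ℕ, (p n * z ^ n * f (z ^ n) - p n * z ^ n * P.eval (z ^ n))| ≤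
        (∑' n : ℕ, p n * z ^ n) * η := by
      rw [← Real.norm_eq_abs]
      refine tsum_of_norm_bounded (hs.hasSum.mul_right η) fun n => ?_
      have h0 : 0 ≤ p n * z ^ n := mul_nonneg (hpos n) (pow_nonneg hz.1.le n)
      rw [← mul_sub, norm_mul, Real.norm_of_nonneg h0, norm_sub_rev]
      exact mul_le_mul_of_nonneg_left
        (hP _ ⟨pow_nonneg hz.1.le n, pow_le_one₀ hz.1.le hz.2.le⟩).le h0
    calc (1 - z) ^ α * _ ≤ (1 - z) ^ α * ((∑' n : ℕ, p n * z ^ n) * η) :=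
          mul_le_mul_of_nonneg_left hb h1z
      _ = η * ((∑' n : ℕ, p n * z ^ n) * (1 - z) ^ α) := by ring
      _ ≤ η * (C + 1) := by gcongr
  rw [Real.dist_eq] at hPz ⊢
  rw [abs_lt] at hPz ⊢
  rw [abs_le] at hsum hintegral
  constructor <;> linarith [hPz.1, hPz.2, hsum.1, hsum.2, hintegral.1, hintegral.2]

theorem tendsto_exp_neg_inv_nat :
    Tendsto (fun n : ℕ => Real.exp (-(n : ℝ)⁻¹)) atTop (𝓝[Ioo 0 1] 1) := by
  refine tendsto_nhdsWithin_iff.2 ⟨?_, ?_⟩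
  · have h : Tendsto (fun n : ℕ => -(n : ℝ)⁻¹) atTop (𝓝 0) := by
      simpa using (tendsto_inv_atTop_nhds_zero_nat (𝕜 := ℝ)).neg
    simpa [Function.comp_def] using (Real.continuous_exp.tendsto 0).comp h
  · filter_upwards [eventually_gt_atTop 0] with n hn
    exact ⟨by positivity, Real.exp_lt_one_iff.2 (by simpa using hn)⟩

theorem continuous_comp_neg_log_div {φ : ℝ → ℝ} (hφ : Continuous φ) {a b : ℝ}
    (hsupp : ∀ s, s ∉ Icc a b → φ s = 0) : Continuous fun t : ℝ => φ (-Real.log t) / t := by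
  refine continuous_iff_continuousAt.2 fun t => ?_
  rcases eq_or_ne t 0 with rfl | ht
  · have hev : (fun _ : ℝ => (0 : ℝ)) =ᶠ[𝓝 0] fun t : ℝ => φ (-Real.log t) / t := by
      have hball := Metric.ball_mem_nhds (0 : ℝ) (Real.exp_pos (-b))
      filter_upwards [hball] with t ht
      rcases eq_or_ne t 0 with rfl | h0
      · simp
      · have : Real.log t < -b := by
          rw [← Real.log_abs, Real.log_lt_iff_lt_exp (abs_pos.2 h0)]
          simpa using ht
        rw [hsupp _ fun h => by linarith [h.2], zero_div]
    exact continuousAt_const.congr hev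
  · exact (hφ.continuousAt.comp (Real.continuousAt_log ht).neg).div continuousAt_id ht

theorem tendsto_weighted_sum_scaled (hpos : ∀ n, 0 ≤ p n) (hC : 0 < C) (hα : 0 < α)
    (hF : Tendsto (fun z : ℝ => (∑' n : ℕ, p n * z ^ n) * (1 - z) ^ α) (𝓝[Ioo 0 1] 1) (𝓝 C))
    {φ : ℝ → ℝ} (hφ : Continuous φ) {a b : ℝ}
    (hsupp : ∀ s, s ∉ Icc a b → φ s = 0) :
    Tendsto (fun n : ℕ => (1 - Real.exp (-(n : ℝ)⁻¹)) ^ α * ∑' k : ℕ, p k * φ (k / n)) atTop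
      (𝓝 (C / Real.Gamma α * ∫ s in Ioi (0 : ℝ), φ s * s ^ (α - 1))) := by
  have h := (tendsto_weighted_sum_continuous hpos hC hα hF
    (continuous_comp_neg_log_div hφ hsupp)).comp tendsto_exp_neg_inv_nat
  convert h using 2 with n
  · simp only [Function.comp_apply]
    congr 1
    refine tsum_congr fun k => ?_
    rw [← Real.exp_nat_mul, Real.log_exp, mul_assoc, mul_div_cancel₀ _ (Real.exp_pos _).ne']
    congr 2
    rw [div_eq_mul_inv]
    ring
  · congr 1
    refine integral_congr_ae (ae_of_all _ fun s => ?_)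
    simp only [Real.log_exp, neg_neg]
    field_simp

theorem integrableOn_mul_rpow_of_support (hα : 0 < α) {φ : ℝ → ℝ} (hφ : Continuous φ) {a b : ℝ}
    (hsupp : ∀ s, s ∉ Icc a b → φ s = 0) :
    IntegrableOn (fun s : ℝ => φ s * s ^ (α - 1)) (Ioi 0) := by
  refine (integrableOn_comp_exp_neg_mul_gamma hα
    (continuous_comp_neg_log_div hφ hsupp)).congr_fun (fun s _ => ?_) measurableSet_Ioi
  simp only [Real.log_exp, neg_neg]
  field_simp

theorem tendsto_tsum_one_mul :
    Tendsto (fun z : ℝ => (∑' n : ℕ, (fun _ : ℕ => (1 : ℝ)) n * z ^ n) * (1 - z) ^ (1 : ℝ))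
      (𝓝[Ioo 0 1] 1) (𝓝 1) := by
  refine tendsto_const_nhds.congr' ?_
  filter_upwards [self_mem_nhdsWithin] with z hz
  have : 1 - z ≠ 0 := by linarith [hz.2]
  simp [tsum_geometric_of_lt_one hz.1.le hz.2, this]

theorem tendsto_riemann_sum {φ : ℝ → ℝ} (hφ : Continuous φ) {a b : ℝ}
    (hsupp : ∀ s, s ∉ Icc a b → φ s = 0) :
    Tendsto (fun n : ℕ => (1 - Real.exp (-(n : ℝ)⁻¹)) * ∑' k : ℕ, φ (k / n)) atTop
      (𝓝 (∫ s in Ioi (0 : ℝ), φ s)) := by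
  simpa using tendsto_weighted_sum_scaled (fun _ => zero_le_one) one_pos one_pos
    tendsto_tsum_one_mul hφ hsupp

theorem summable_mul_scaled {φ : ℝ → ℝ} {a b : ℝ} (hsupp : ∀ s, s ∉ Icc a b → φ s = 0)
    (q : ℕ → ℝ) {n : ℕ} (hn : 0 < n) : Summable fun k : ℕ => q k * φ (k / n) := by
  have hn' : (0 : ℝ) < n := by exact_mod_cast hn
  refine summable_of_ne_finset_zero (s := Finset.range (⌈b * n⌉₊ + 1)) fun k hk => ?_
  rw [hsupp, mul_zero]
  intro h
  have h1 : (k : ℝ) ≤ b * n := (div_le_iff₀ hn').1 h.2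
  have h2 : (k : ℝ) ≤ ⌈b * n⌉₊ := h1.trans (Nat.le_ceil _)
  exact hk (Finset.mem_range.2 (Nat.lt_succ_of_le (by exact_mod_cast h2)))

theorem exists_bump {a b : ℝ} (ha : 0 < a) (hab : a < b) :
    ∃ φ : ℝ → ℝ, Continuous φ ∧ (∀ s, 0 ≤ φ s) ∧ (∀ s, s ∉ Icc a b → φ s = 0) ∧
      0 < ∫ s in Ioi (0 : ℝ), φ s := by
  have hcont : Continuous fun s : ℝ => max 0 ((s - a) * (b - s)) := by fun_prop
  have hsupp : ∀ s : ℝ, s ∉ Icc a b → max 0 ((s - a) * (b - s)) = 0 := fun s hs => by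
    refine max_eq_left ?_
    rcases lt_or_ge s a with h | h
    · nlinarith
    · have : b < s := not_le.1 fun hsb => hs ⟨h, hsb⟩
      nlinarith
  refine ⟨_, hcont, fun s => le_max_left _ _, hsupp, ?_⟩
  have hint : IntegrableOn (fun s : ℝ => max 0 ((s - a) * (b - s))) (Ioi 0) := by
    simpa using integrableOn_mul_rpow_of_support one_pos hcont hsupp
  have hnonneg : 0 ≤ᵐ[volume.restrict (Ioi 0)] fun s : ℝ => max 0 ((s - a) * (b - s)) :=
    ae_of_all _ fun s => le_max_left _ _
  rw [setIntegral_pos_iff_support_of_nonneg_ae hnonneg hint]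
  have hsub : Ioo a b ⊆ (Function.support fun s : ℝ => max 0 ((s - a) * (b - s))) ∩ Ioi 0 :=
    fun s hs => ⟨(lt_max_of_lt_right
      (mul_pos (sub_pos.2 hs.1) (sub_pos.2 hs.2))).ne', ha.trans hs.1⟩
  refine lt_of_lt_of_le ?_ (measure_mono hsub)
  simpa using hab

theorem one_sub_exp_neg_inv_pos {n : ℕ} (hn : 0 < n) : 0 < 1 - Real.exp (-(n : ℝ)⁻¹) :=
  sub_pos.2 (Real.exp_lt_one_iff.2 (by simpa using hn))

theorem eventually_lt_of_le_window (hpos : ∀ n, 0 ≤ p n) (hC : 0 < C) (hα : 0 < α)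
    (hF : Tendsto (fun z : ℝ => (∑' n : ℕ, p n * z ^ n) * (1 - z) ^ α) (𝓝[Ioo 0 1] 1) (𝓝 C))
    {a b M B : ℝ} (ha : 0 < a) (hab : a < b) (hM : ∀ s ∈ Icc a b, s ^ (α - 1) ≤ M)
    (hp : ∀ᶠ n : ℕ in atTop, ∀ k : ℕ, (k / n : ℝ) ∈ Icc a b → p n ≤ p k)
    (hB : C / Real.Gamma α * M < B) :
    ∀ᶠ n : ℕ in atTop, p n * (1 - Real.exp (-(n : ℝ)⁻¹)) ^ (α - 1) < B := by
  obtain ⟨φ, hφ, hφ0, hsupp, hφpos⟩ := exists_bump ha hab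
  have hc : 0 < C / Real.Gamma α := div_pos hC (Real.Gamma_pos_of_pos hα)
  have hI : ∫ s in Ioi (0 : ℝ), φ s * s ^ (α - 1) ≤ (∫ s in Ioi (0 : ℝ), φ s) * M := by
    rw [← integral_mul_const]
    refine setIntegral_mono (integrableOn_mul_rpow_of_support hα hφ hsupp) ?_ fun s => ?_
    · have : IntegrableOn φ (Ioi 0) := by
        simpa using integrableOn_mul_rpow_of_support one_pos hφ hsupp
      exact this.mul_const M
    · by_cases hs : s ∈ Icc a b
      · exact mul_le_mul_of_nonneg_left (hM s hs) (hφ0 s)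
      · simp [hsupp s hs]
  have hR := tendsto_riemann_sum hφ hsupp
  have hlim := (tendsto_weighted_sum_scaled hpos hC hα hF hφ hsupp).div hR hφpos.ne'
  have hlt : (C / Real.Gamma α * ∫ s in Ioi (0 : ℝ), φ s * s ^ (α - 1)) /
      (∫ s in Ioi (0 : ℝ), φ s) < B := by
    rw [div_lt_iff₀ hφpos]
    nlinarith [mul_le_mul_of_nonneg_left hI hc.le, mul_lt_mul_of_pos_right hB hφpos]
  filter_upwards [hlim.eventually_lt_const hlt, hR.eventually_const_lt hφpos, hp,
    eventually_gt_atTop 0] with n hn hRn hpn hn0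
  refine lt_of_le_of_lt ?_ hn
  have hx := one_sub_exp_neg_inv_pos hn0
  have hsum : p n * ∑' k : ℕ, φ (k / n) ≤ ∑' k : ℕ, p k * φ (k / n) := by
    rw [← tsum_mul_left]
    refine (summable_mul_scaled hsupp (fun _ => p n) hn0).tsum_le_tsum (fun k => ?_)
      (summable_mul_scaled hsupp p hn0)
    by_cases hk : (k / n : ℝ) ∈ Icc a b
    · exact mul_le_mul_of_nonneg_right (hpn k hk) (hφ0 _)
    · simp [hsupp _ hk]
  rw [Pi.div_apply, le_div_iff₀ hRn]
  calc _ = ((1 - Real.exp (-(n : ℝ)⁻¹)) ^ (α - 1) * (1 - Real.exp (-(n : ℝ)⁻¹))) *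
        (p n * ∑' k : ℕ, φ (k / n)) := by ring
    _ = (1 - Real.exp (-(n : ℝ)⁻¹)) ^ α * (p n * ∑' k : ℕ, φ (k / n)) := by
        rw [← Real.rpow_add_one hx.ne', sub_add_cancel]
    _ ≤ _ := by gcongr

theorem eventually_gt_of_ge_window (hpos : ∀ n, 0 ≤ p n) (hC : 0 < C) (hα : 0 < α)
    (hF : Tendsto (fun z : ℝ => (∑' n : ℕ, p n * z ^ n) * (1 - z) ^ α) (𝓝[Ioo 0 1] 1) (𝓝 C))
    {a b M B : ℝ} (ha : 0 < a) (hab : a < b) (hM : ∀ s ∈ Icc a b, M ≤ s ^ (α - 1))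
    (hp : ∀ᶠ n : ℕ in atTop, ∀ k : ℕ, (k / n : ℝ) ∈ Icc a b → p k ≤ p n)
    (hB : B < C / Real.Gamma α * M) :
    ∀ᶠ n : ℕ in atTop, B < p n * (1 - Real.exp (-(n : ℝ)⁻¹)) ^ (α - 1) := by
  obtain ⟨φ, hφ, hφ0, hsupp, hφpos⟩ := exists_bump ha hab
  have hc : 0 < C / Real.Gamma α := div_pos hC (Real.Gamma_pos_of_pos hα)
  have hI : (∫ s in Ioi (0 : ℝ), φ s) * M ≤ ∫ s in Ioi (0 : ℝ), φ s * s ^ (α - 1) := by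
    rw [← integral_mul_const]
    refine setIntegral_mono ?_ (integrableOn_mul_rpow_of_support hα hφ hsupp) fun s => ?_
    · have : IntegrableOn φ (Ioi 0) := by
        simpa using integrableOn_mul_rpow_of_support one_pos hφ hsupp
      exact this.mul_const M
    · by_cases hs : s ∈ Icc a b
      · exact mul_le_mul_of_nonneg_left (hM s hs) (hφ0 s)
      · simp [hsupp s hs]
  have hR := tendsto_riemann_sum hφ hsupp
  have hlim := (tendsto_weighted_sum_scaled hpos hC hα hF hφ hsupp).div hR hφpos.ne'
  have hlt : B < (C / Real.Gamma α * ∫ s in Ioi (0 : ℝ), φ s * s ^ (α - 1)) /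
      (∫ s in Ioi (0 : ℝ), φ s) := by
    rw [lt_div_iff₀ hφpos]
    nlinarith [mul_le_mul_of_nonneg_left hI hc.le, mul_lt_mul_of_pos_right hB hφpos]
  filter_upwards [hlim.eventually_const_lt hlt, hR.eventually_const_lt hφpos, hp,
    eventually_gt_atTop 0] with n hn hRn hpn hn0
  refine lt_of_lt_of_le hn ?_
  have hx := one_sub_exp_neg_inv_pos hn0
  have hsum : ∑' k : ℕ, p k * φ (k / n) ≤ p n * ∑' k : ℕ, φ (k / n) := by
    rw [← tsum_mul_left]
    refine (summable_mul_scaled hsupp p hn0).tsum_le_tsum (fun k => ?_)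
      (summable_mul_scaled hsupp (fun _ => p n) hn0)
    by_cases hk : (k / n : ℝ) ∈ Icc a b
    · exact mul_le_mul_of_nonneg_right (hpn k hk) (hφ0 _)
    · simp [hsupp _ hk]
  rw [Pi.div_apply, div_le_iff₀ hRn]
  calc _ ≤ (1 - Real.exp (-(n : ℝ)⁻¹)) ^ α * (p n * ∑' k : ℕ, φ (k / n)) := by gcongr
    _ = ((1 - Real.exp (-(n : ℝ)⁻¹)) ^ (α - 1) * (1 - Real.exp (-(n : ℝ)⁻¹))) *
        (p n * ∑' k : ℕ, φ (k / n)) := by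
        rw [← Real.rpow_add_one hx.ne', sub_add_cancel]
    _ = _ := by ring

/-- It suffices to compare `p n` with the values of `p` on windows `[a n, b n]` close to `n`. -/
theorem tendsto_of_windows (hpos : ∀ n, 0 ≤ p n) (hC : 0 < C) (hα : 0 < α)
    (hF : Tendsto (fun z : ℝ => (∑' n : ℕ, p n * z ^ n) * (1 - z) ^ α) (𝓝[Ioo 0 1] 1) (𝓝 C))
    (hup : ∀ δ ∈ Ioo (0 : ℝ) 1, ∃ a b, 1 - δ ≤ a ∧ a < b ∧ b ≤ 1 + δ ∧
      ∀ᶠ n : ℕ in atTop, ∀ k : ℕ, (k / n : ℝ) ∈ Icc a b → p n ≤ p k)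
    (hlow : ∀ δ ∈ Ioo (0 : ℝ) 1, ∃ a b, 1 - δ ≤ a ∧ a < b ∧ b ≤ 1 + δ ∧
      ∀ᶠ n : ℕ in atTop, ∀ k : ℕ, (k / n : ℝ) ∈ Icc a b → p k ≤ p n) :
    Tendsto (fun n : ℕ => p n * (1 - Real.exp (-(n : ℝ)⁻¹)) ^ (α - 1)) atTop
      (𝓝 (C / Real.Gamma α)) := by
  have hc : 0 < C / Real.Gamma α := div_pos hC (Real.Gamma_pos_of_pos hα)
  have hwindow : ∀ η > 0, ∃ δ ∈ Ioo (0 : ℝ) 1, ∀ s ∈ Icc (1 - δ) (1 + δ),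
      |s ^ (α - 1) - 1| < η := by
    intro η hη
    have hcont : ContinuousAt (fun s : ℝ => s ^ (α - 1)) 1 :=
      Real.continuousAt_rpow_const 1 _ (Or.inl one_ne_zero)
    obtain ⟨δ, hδ, h⟩ := Metric.continuousAt_iff.1 hcont η hη
    refine ⟨min (δ / 2) (1 / 2), ⟨by positivity, ?_⟩, fun s hs => ?_⟩
    · exact (min_le_right _ _).trans_lt (by norm_num)
    · have := min_le_left (δ / 2) (1 / 2)
      simpa [Real.dist_eq] using h (x := s) (by
        rw [Real.dist_eq, abs_lt]
        constructor <;> linarith [hs.1, hs.2])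
  have hη : ∀ B, B ≠ C / Real.Gamma α → 0 < |B - C / Real.Gamma α| / (2 * (C / Real.Gamma α)) :=
    fun B hB => div_pos (abs_pos.2 (sub_ne_zero.2 hB)) (by positivity)
  have hmul : ∀ B, C / Real.Gamma α * (|B - C / Real.Gamma α| / (2 * (C / Real.Gamma α))) =
      |B - C / Real.Gamma α| / 2 := fun B => by field_simp
  refine tendsto_order.2 ⟨fun B hB => ?_, fun B hB => ?_⟩
  · obtain ⟨δ, hδ, h⟩ := hwindow _ (hη B hB.ne)
    obtain ⟨a, b, ha, hab, hb, hp⟩ := hlow δ hδ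
    refine eventually_gt_of_ge_window hpos hC hα hF (by linarith [hδ.2]) hab
      (M := 1 - |B - C / Real.Gamma α| / (2 * (C / Real.Gamma α)))
      (fun s hs => ?_) hp ?_
    · linarith [(abs_lt.1 (h s ⟨ha.trans hs.1, hs.2.trans hb⟩)).1]
    · rw [mul_sub, hmul, abs_of_neg (by linarith)]
      linarith
  · obtain ⟨δ, hδ, h⟩ := hwindow _ (hη B hB.ne')
    obtain ⟨a, b, ha, hab, hb, hp⟩ := hup δ hδ
    refine eventually_lt_of_le_window hpos hC hα hF (by linarith [hδ.2]) hab
      (M := 1 + |B - C / Real.Gamma α| / (2 * (C / Real.Gamma α)))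
      (fun s hs => ?_) hp ?_
    · linarith [(abs_lt.1 (h s ⟨ha.trans hs.1, hs.2.trans hb⟩)).2]
    · rw [mul_add, hmul, abs_of_pos (by linarith)]
      linarith

end Karamata

theorem eventually_window_right (N : ℕ) (b : ℝ) :
    ∀ᶠ n : ℕ in atTop, ∀ k : ℕ, (k / n : ℝ) ∈ Icc 1 b → N ≤ n ∧ n ≤ k := by
  filter_upwards [eventually_ge_atTop N, eventually_gt_atTop 0] with n hn hn0 k hk
  have hn' : (0 : ℝ) < n := by exact_mod_cast hn0
  exact ⟨hn, by exact_mod_cast (one_le_div hn').1 hk.1⟩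

theorem eventually_window_left (N : ℕ) {a : ℝ} (ha : 0 < a) :
    ∀ᶠ n : ℕ in atTop, ∀ k : ℕ, (k / n : ℝ) ∈ Icc a 1 → N ≤ k ∧ k ≤ n := by
  filter_upwards [(tendsto_natCast_atTop_atTop.const_mul_atTop ha).eventually_ge_atTop (N : ℝ),
    eventually_gt_atTop 0] with n hn hn0 k hk
  have hn' : (0 : ℝ) < n := by exact_mod_cast hn0
  exact ⟨by exact_mod_cast hn.trans ((le_div_iff₀ hn').1 hk.1),
    by exact_mod_cast (div_le_one hn').1 hk.2⟩

theorem tendsto_nat_mul_one_sub_exp_neg_inv :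
    Tendsto (fun n : ℕ => (n : ℝ) * (1 - Real.exp (-(n : ℝ)⁻¹))) atTop (𝓝 1) := by
  have h0 : Tendsto (fun n : ℕ => -(n : ℝ)⁻¹) atTop (𝓝[≠] 0) := by
    refine tendsto_nhdsWithin_iff.2 ⟨?_, ?_⟩
    · simpa using (tendsto_inv_atTop_nhds_zero_nat (𝕜 := ℝ)).neg
    · filter_upwards [eventually_gt_atTop 0] with n hn
      simpa using hn.ne'
  have h := (hasDerivAt_iff_tendsto_slope_zero.1 (Real.hasDerivAt_exp 0)).comp h0
  rw [Real.exp_zero] at h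
  refine h.congr fun n => ?_
  simp only [Function.comp_apply, zero_add, smul_eq_mul, inv_neg, inv_inv]
  ring

/-- Hardy–Littlewood–Karamata Tauberian theorem: if `p` is nonnegative,
eventually monotone, and its generating function satisfies
`F(z) = ∑ pₙ zⁿ ~ C/(1-z)^α` as `z → 1⁻` with `C > 0`, `α > 0`, then
`pₙ ~ (C/Γ(α))·n^{α-1}` as `n → ∞`. -/
theorem stmt_16 (p : ℕ → ℝ) (hpos : ∀ n, 0 ≤ p n)
    (hmono : (∃ N : ℕ, MonotoneOn p (Set.Ici N)) ∨ (∃ N : ℕ, AntitoneOn p (Set.Ici N)))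
    (C α : ℝ) (hC : 0 < C) (hα : 0 < α)
    (hF : Filter.Tendsto (fun z : ℝ => (∑' n : ℕ, p n * z ^ n) * (1 - z) ^ α)
      (nhdsWithin 1 (Set.Ioo 0 1)) (nhds C)) :
    Filter.Tendsto (fun n : ℕ => p n / (C / Real.Gamma α * (n : ℝ) ^ (α - 1)))
      Filter.atTop (nhds 1) := by
  have hΓ := Real.Gamma_pos_of_pos hα
  have hkey : Tendsto (fun n : ℕ => p n * (1 - Real.exp (-(n : ℝ)⁻¹)) ^ (α - 1)) atTop
      (𝓝 (C / Real.Gamma α)) := by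
    rcases hmono with ⟨N, hN⟩ | ⟨N, hN⟩
    · refine tendsto_of_windows hpos hC hα hF (fun δ hδ => ?_) (fun δ hδ => ?_)
      · refine ⟨1, 1 + δ, by linarith [hδ.1], by linarith [hδ.1], le_rfl, ?_⟩
        filter_upwards [eventually_window_right N (1 + δ)] with n hn k hk
        obtain ⟨h1, h2⟩ := hn k hk
        exact hN h1 (h1.trans h2) h2
      · refine ⟨1 - δ, 1, le_rfl, by linarith [hδ.1], by linarith [hδ.1], ?_⟩
        filter_upwards [eventually_window_left N (sub_pos.2 hδ.2)] with n hn k hk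
        obtain ⟨h1, h2⟩ := hn k hk
        exact hN h1 (h1.trans h2) h2
    · refine tendsto_of_windows hpos hC hα hF (fun δ hδ => ?_) (fun δ hδ => ?_)
      · refine ⟨1 - δ, 1, le_rfl, by linarith [hδ.1], by linarith [hδ.1], ?_⟩
        filter_upwards [eventually_window_left N (sub_pos.2 hδ.2)] with n hn k hk
        obtain ⟨h1, h2⟩ := hn k hk
        exact hN h1 (h1.trans h2) h2
      · refine ⟨1, 1 + δ, by linarith [hδ.1], by linarith [hδ.1], le_rfl, ?_⟩
        filter_upwards [eventually_window_right N (1 + δ)] with n hn k hk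
        obtain ⟨h1, h2⟩ := hn k hk
        exact hN h1 (h1.trans h2) h2
  have hratio : Tendsto (fun n : ℕ => ((n : ℝ) * (1 - Real.exp (-(n : ℝ)⁻¹))) ^ (α - 1)) atTop
      (𝓝 1) := by
    simpa using tendsto_nat_mul_one_sub_exp_neg_inv.rpow_const (p := α - 1) (Or.inl one_ne_zero)
  have hlim := (hkey.div hratio one_ne_zero).div_const (C / Real.Gamma α)
  rw [div_one, div_self (by positivity)] at hlim
  refine hlim.congr' ?_
  filter_upwards [eventually_gt_atTop 0] with n hn
  have hn' : (0 : ℝ) < n := by exact_mod_cast hn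
  have hx := Real.rpow_pos_of_pos (one_sub_exp_neg_inv_pos hn) (α - 1)
  have hnα := Real.rpow_pos_of_pos hn' (α - 1)
  rw [Pi.div_apply, Real.mul_rpow hn'.le (one_sub_exp_neg_inv_pos hn).le,
    mul_div_mul_right _ _ hx.ne', div_div, mul_comm]
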